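/- Let 0 ≤ η̂ ≤ (π/5)·(10/π² − 1) and let u : ℝ → ℝ be a C² function which is 2π-periodic with zero average. Set g(t) := u''(t) + η̂·u'(t). Then ‖u‖ ≤ (5/4) · ‖g‖. -/

import Mathlib

open Real

theorem Function.Periodic.deriv_periodic {f : ℝ → ℝ} {T : ℝ} (hf : Function.Periodic f T) :
    Function.Periodic (deriv f) T := by
  intro x
  rw [← deriv_comp_add_const, show (fun y => f (y + T)) = f from funext hf]

theorem Function.Periodic.bddAbove_range_abs {f : ℝ → ℝ} {T : ℝ} (hf : Function.Periodic f T)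
    (hT : T ≠ 0) (hc : Continuous f) : BddAbove (Set.range fun t => |f t|) := by
  have h : Function.Periodic (fun t => |f t|) T := fun x => by simp only [hf x]
  exact (h.compact_of_continuous hT hc.abs).bddAbove

theorem integral_abs_symm_pi : ∫ x in (-π)..π, |x| = π ^ 2 := by
  have hi : ∀ a b : ℝ, IntervalIntegrable (fun x : ℝ => |x|) MeasureTheory.volume a b :=
    fun a b => continuous_abs.intervalIntegrable a b
  rw [← intervalIntegral.integral_add_adjacent_intervals (hi (-π) 0) (hi 0 π)]
  have h₁ : ∫ x in (-π)..0, |x| = ∫ x in (-π)..0, -x := by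
    refine intervalIntegral.integral_congr fun x hx => ?_
    rw [Set.uIcc_of_le (by linarith [pi_pos])] at hx
    exact abs_of_nonpos hx.2
  have h₂ : ∫ x in (0 : ℝ)..π, |x| = ∫ x in (0 : ℝ)..π, x := by
    refine intervalIntegral.integral_congr fun x hx => ?_
    rw [Set.uIcc_of_le pi_pos.le] at hx
    exact abs_of_nonneg hx.1
  rw [h₁, h₂, intervalIntegral.integral_neg, integral_id, integral_id]
  ring

theorem integral_abs_sq_sub_symm_pi :
    ∫ x in (-π)..π, |(x ^ 2 - π ^ 2 / 4) / 2| = π ^ 3 / 4 := by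
  have hπ := pi_pos
  have hi : ∀ a b : ℝ, IntervalIntegrable (fun x : ℝ => |(x ^ 2 - π ^ 2 / 4) / 2|)
      MeasureTheory.volume a b := fun a b => Continuous.intervalIntegrable (by fun_prop) a b
  have hJ : ∀ a b : ℝ, ∫ x in a..b, (x ^ 2 - π ^ 2 / 4) / 2 =
      ((b ^ 3 - a ^ 3) / 3 - (b - a) * (π ^ 2 / 4)) / 2 := by
    intro a b
    rw [intervalIntegral.integral_div, intervalIntegral.integral_sub
      (Continuous.intervalIntegrable (by fun_prop) a b) (by simp), integral_pow]
    norm_num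
    ring
  rw [← intervalIntegral.integral_add_adjacent_intervals (hi (-π) (-(π / 2))) (hi (-(π / 2)) π),
    ← intervalIntegral.integral_add_adjacent_intervals (hi (-(π / 2)) (π / 2)) (hi (π / 2) π)]
  have h₁ : ∫ x in (-π)..(-(π / 2)), |(x ^ 2 - π ^ 2 / 4) / 2| =
      ∫ x in (-π)..(-(π / 2)), (x ^ 2 - π ^ 2 / 4) / 2 := by
    refine intervalIntegral.integral_congr fun x hx => ?_
    rw [Set.uIcc_of_le (by linarith)] at hx
    exact abs_of_nonneg (by nlinarith [hx.1, hx.2])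
  have h₂ : ∫ x in (-(π / 2))..(π / 2), |(x ^ 2 - π ^ 2 / 4) / 2| =
      ∫ x in (-(π / 2))..(π / 2), -((x ^ 2 - π ^ 2 / 4) / 2) := by
    refine intervalIntegral.integral_congr fun x hx => ?_
    rw [Set.uIcc_of_le (by linarith)] at hx
    exact abs_of_nonpos (by nlinarith [hx.1, hx.2])
  have h₃ : ∫ x in (π / 2)..π, |(x ^ 2 - π ^ 2 / 4) / 2| =
      ∫ x in (π / 2)..π, (x ^ 2 - π ^ 2 / 4) / 2 := by
    refine intervalIntegral.integral_congr fun x hx => ?_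
    rw [Set.uIcc_of_le (by linarith)] at hx
    exact abs_of_nonneg (by nlinarith [hx.1, hx.2])
  rw [h₁, h₂, h₃, intervalIntegral.integral_neg, hJ, hJ, hJ]
  ring

theorem abs_integral_mul_le_of_abs_le {k f : ℝ → ℝ} {a b M : ℝ} (hab : a ≤ b)
    (hk : Continuous k) (hM : ∀ t, |f t| ≤ M) :
    |∫ x in a..b, k x * f x| ≤ (∫ x in a..b, |k x|) * M := by
  rw [← intervalIntegral.integral_mul_const, ← Real.norm_eq_abs]
  refine intervalIntegral.norm_integral_le_of_norm_le hab (.of_forall fun x _ => ?_)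
    (Continuous.intervalIntegrable (by fun_prop) a b)
  rw [norm_mul, Real.norm_eq_abs, Real.norm_eq_abs]
  exact mul_le_mul_of_nonneg_left (hM x) (abs_nonneg _)

/-- Integrating the derivative of a zero-average periodic function against a sawtooth
recovers the value of the function at the jump. -/
theorem integral_sawtooth_mul_deriv {v : ℝ → ℝ} (hv : ContDiff ℝ 1 v)
    (hper : Function.Periodic v (2 * π)) (havg : ∫ t in (0 : ℝ)..(2 * π), v t = 0) (p : ℝ) :
    ∫ x in p..(p + 2 * π), (x - (p + π)) * deriv v x = 2 * π * v p := by
  have hd : Continuous (deriv v) := hv.continuous_deriv le_rfl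
  rw [intervalIntegral.integral_mul_deriv_eq_deriv_mul (u' := fun _ => 1)
    (fun x _ => (hasDerivAt_id' x).sub_const _)
    (fun x _ => (hv.differentiable one_ne_zero x).hasDerivAt)
    (by simp) (hd.intervalIntegrable _ _)]
  have h := hper.intervalIntegral_add_eq p 0
  rw [zero_add, havg] at h
  simp only [one_mul, h, hper p]
  ring

/-- The Bohr–Favard inequality of order one. -/
theorem abs_le_of_abs_deriv_le_of_periodic {v : ℝ → ℝ} (hv : ContDiff ℝ 1 v)
    (hper : Function.Periodic v (2 * π)) (havg : ∫ t in (0 : ℝ)..(2 * π), v t = 0) {M : ℝ}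
    (hM : ∀ t, |deriv v t| ≤ M) (p : ℝ) : |v p| ≤ π / 2 * M := by
  have hπ := pi_pos
  have h := abs_integral_mul_le_of_abs_le (k := fun x => x - (p + π)) (a := p) (b := p + 2 * π)
    (by linarith) (by fun_prop) hM
  rw [integral_sawtooth_mul_deriv hv hper havg,
    intervalIntegral.integral_comp_sub_right (fun x => |x|),
    show p - (p + π) = -π by ring, show p + 2 * π - (p + π) = π by ring,
    integral_abs_symm_pi, abs_mul, abs_of_pos (by positivity)] at h
  have : 2 * π * |v p| ≤ 2 * π * (π / 2 * M) := h.trans_eq (by ring)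
  exact le_of_mul_le_mul_left this (by positivity)

/-- The Bohr–Favard inequality of order two. -/
theorem abs_le_of_abs_deriv_deriv_le_of_periodic {u : ℝ → ℝ} (hu : ContDiff ℝ 2 u)
    (hper : Function.Periodic u (2 * π)) (havg : ∫ t in (0 : ℝ)..(2 * π), u t = 0) {M : ℝ}
    (hM : ∀ t, |deriv (deriv u) t| ≤ M) (p : ℝ) : |u p| ≤ π ^ 2 / 8 * M := by
  have hπ := pi_pos
  have hu' : ContDiff ℝ 1 (deriv u) := hu.deriv'
  have hu'' : Continuous (deriv (deriv u)) := hu'.continuous_deriv le_rfl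
  have h := abs_integral_mul_le_of_abs_le
    (k := fun x => ((x - (p + π)) ^ 2 - π ^ 2 / 4) / 2) (a := p) (b := p + 2 * π)
    (by linarith) (by fun_prop) hM
  have hk : ∀ x : ℝ, HasDerivAt (fun x => ((x - (p + π)) ^ 2 - π ^ 2 / 4) / 2)
      (x - (p + π)) x := by
    intro x
    refine (((((hasDerivAt_id' x).sub_const (p + π)).pow 2).sub_const
      (π ^ 2 / 4)).div_const 2).congr_deriv ?_
    simp
  rw [intervalIntegral.integral_mul_deriv_eq_deriv_mul (fun x _ => hk x)
      (fun x _ => (hu'.differentiable one_ne_zero x).hasDerivAt)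
      (Continuous.intervalIntegrable (by fun_prop) _ _) (hu''.intervalIntegrable _ _),
    integral_sawtooth_mul_deriv (hu.of_le one_le_two) hper havg, hper.deriv_periodic p,
    intervalIntegral.integral_comp_sub_right (fun x => |(x ^ 2 - π ^ 2 / 4) / 2|),
    show p - (p + π) = -π by ring, show p + 2 * π - (p + π) = π by ring,
    integral_abs_sq_sub_symm_pi, neg_sq, sub_self, zero_sub, abs_neg, abs_mul,
    abs_of_pos (by positivity)] at h
  have : 2 * π * |u p| ≤ 2 * π * (π ^ 2 / 8 * M) := h.trans_eq (by ring)
  exact le_of_mul_le_mul_left this (by positivity)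

theorem stmt_4 (η : ℝ) (hη0 : 0 ≤ η) (hη : η ≤ (π / 5) * (10 / π ^ 2 - 1))
    (u : ℝ → ℝ) (hu : ContDiff ℝ 2 u)
    (hper : Function.Periodic u (2 * π))
    (havg : ∫ t in (0:ℝ)..(2 * π), u t = 0)
    (g : ℝ → ℝ) (hg : ∀ t, g t = deriv (deriv u) t + η * deriv u t) :
    (⨆ t : ℝ, |u t|) ≤ (5 / 4) * ⨆ t : ℝ, |g t| := by
  have hπ := pi_pos
  have hT : 2 * π ≠ 0 := by positivity
  have hu' : ContDiff ℝ 1 (deriv u) := hu.deriv'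
  have hu'' : Continuous (deriv (deriv u)) := hu'.continuous_deriv le_rfl
  have hper' := hper.deriv_periodic
  have hper'' := hper'.deriv_periodic
  have havg' : ∫ t in (0 : ℝ)..(2 * π), deriv u t = 0 := by
    rw [intervalIntegral.integral_deriv_eq_sub
      (fun x _ => hu.differentiable two_ne_zero x) (hu'.continuous.intervalIntegrable _ _),
      hper.eq, sub_self]
  have hgc : Continuous g := by
    rw [funext hg]
    exact hu''.add (continuous_const.mul hu'.continuous)
  have hgper : Function.Periodic g (2 * π) := fun x => by rw [hg, hg, hper' x, hper'' x]
  set G := ⨆ t : ℝ, |g t|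
  set M := ⨆ t : ℝ, |deriv (deriv u) t|
  have hG : ∀ t, |g t| ≤ G := le_ciSup (hgper.bddAbove_range_abs hT hgc)
  have hM : ∀ t, |deriv (deriv u) t| ≤ M := le_ciSup (hper''.bddAbove_range_abs hT hu'')
  have hM0 : 0 ≤ M := (abs_nonneg _).trans (hM 0)
  have hMG : M ≤ G + η * (π / 2 * M) := by
    refine ciSup_le fun t => ?_
    have h₁ := abs_le_of_abs_deriv_le_of_periodic hu' hper' havg' hM t
    calc |deriv (deriv u) t| = |g t - η * deriv u t| := by rw [hg]; ring_nf
      _ ≤ |g t| + |η * deriv u t| := abs_sub _ _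
      _ ≤ G + η * (π / 2 * M) := by
        rw [abs_mul, abs_of_nonneg hη0]
        exact add_le_add (hG t) (mul_le_mul_of_nonneg_left h₁ hη0)
  have hηπ : η * (π / 2) ≤ 1 - π ^ 2 / 10 := by
    calc η * (π / 2) ≤ (π / 5) * (10 / π ^ 2 - 1) * (π / 2) := by gcongr
      _ = 1 - π ^ 2 / 10 := by field_simp; ring
  refine ciSup_le fun t => ?_
  have h₂ := abs_le_of_abs_deriv_deriv_le_of_periodic hu hper havg hM t
  have h₃ := mul_le_mul_of_nonneg_right hηπ hM0
  linarith
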